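/- arXiv:1907.04416 — 3 statements merged into one kernel-verified Lean document; each statement's English description precedes it below -/
import Mathlib

section
/- For all integers ℓ ≥ 3 and v, every Steiner triple system of order v with v ≥ (ℓ−1)(ℓ^5 − 9ℓ^3 + 20ℓ^2 − 36ℓ + 16)/16 has an ℓ-good sequencing. -/
/-- A Steiner triple system of order `v` on the point set `{1, …, v}`:
`B` is a set of 3-element blocks, each a subset of `{1, …, v}`, such that every pair of
distinct points of `{1, …, v}` lies in exactly one block. -/
def IsSTS (v : ℕ) (B : Finset (Finset ℕ)) : Prop :=
  (∀ b ∈ B, b ⊆ Finset.Icc 1 v ∧ b.card = 3) ∧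
  ∀ p ∈ Finset.Icc 1 v, ∀ q ∈ Finset.Icc 1 v, p ≠ q →
    ∃! b, b ∈ B ∧ p ∈ b ∧ q ∈ b

/-- `x` lists the points of `{1, …, v}` at positions `1, …, v` (a permutation of the points),
and no `ℓ` consecutive points `x i, x (i+1), …, x (i+ℓ-1)` of the sequencing contain a
block of `B`. -/
def IsGoodSeq (v ℓ : ℕ) (B : Finset (Finset ℕ)) (x : ℕ → ℕ) : Prop :=
  Set.BijOn x (Set.Icc 1 v) (Set.Icc 1 v) ∧
  ∀ i : ℕ, 1 ≤ i → ∀ b ∈ B,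
    ¬ (↑b : Set ℕ) ⊆ x '' (Set.Icc i (i + ℓ - 1) ∩ Set.Icc 1 v)

open Finset in
/-- The two facts used about the blocks. -/
def PS (v : ℕ) (B : Finset (Finset ℕ)) : Prop :=
  (∀ b ∈ B, b ⊆ Finset.Icc 1 v ∧ b.card = 3) ∧
  ∀ a b y z : ℕ, ({a, b, y} : Finset ℕ) ∈ B → ({a, b, z} : Finset ℕ) ∈ B → y = z

def near (l p q : ℕ) : Prop := p < q + l ∧ q < p + l

/-- `f` is a good partial sequencing with set of positions `P`. -/
def GoodP (v l : ℕ) (B : Finset (Finset ℕ)) (P : Finset ℕ) (f : ℕ → ℕ) : Prop :=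
  (∀ p ∈ P, ∀ q ∈ P, f p = f q → p = q) ∧ (∀ p ∈ P, f p ∈ Finset.Icc 1 v) ∧
  ∀ p ∈ P, ∀ q ∈ P, ∀ r ∈ P, near l p q → near l p r → near l q r →
    ({f p, f q, f r} : Finset ℕ) ∉ B

open Classical in
noncomputable def forb (v l : ℕ) (B : Finset (Finset ℕ)) (P : Finset ℕ) (f : ℕ → ℕ) (p : ℕ) :
    Finset ℕ :=
  (Finset.Icc 1 v).filter (fun y => ∃ q ∈ P, ∃ r ∈ P, near l p q ∧ near l p r ∧ near l q r ∧
    ({f q, f r, y} : Finset ℕ) ∈ B)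

open Classical in
noncomputable def third (v : ℕ) (B : Finset (Finset ℕ)) (a b : ℕ) : Finset ℕ :=
  (Finset.Icc 1 v).filter (fun y => ({a, b, y} : Finset ℕ) ∈ B)

def prs (l : ℕ) : Finset (Σ _ : ℕ, ℕ) := (Finset.range (l - 1)).sigma (fun j => Finset.range j)

theorem near_symm {l p q : ℕ} (h : near l p q) : near l q p := ⟨h.2, h.1⟩

theorem ps_of_sts {v : ℕ} {B : Finset (Finset ℕ)} (h : IsSTS v B) : PS v B := by
  refine ⟨h.1, ?_⟩
  intro a b y z h1 h2
  have c1 := (h.1 _ h1)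
  have c2 := (h.1 _ h2)
  have hab : a ≠ b := by
    rintro rfl
    have := c1.2
    have h3 := Finset.card_le_two (a := a) (b := y)
    simp at this
    omega
  have hy : y ≠ a ∧ y ≠ b := by
    constructor
    · rintro rfl
      have := c1.2
      have h3 := Finset.card_le_two (a := y) (b := b)
      rw [show ({y, b, y} : Finset ℕ) = {y, b} by ext; simp; tauto] at this
      omega
    · rintro rfl
      have := c1.2
      have h3 := Finset.card_le_two (a := a) (b := y)
      simp at this
      omega
  have ha : a ∈ Finset.Icc 1 v := c1.1 (by simp)
  have hb : b ∈ Finset.Icc 1 v := c1.1 (by simp)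
  have e := (h.2 a ha b hb hab).unique ⟨h1, by simp, by simp⟩ ⟨h2, by simp, by simp⟩
  have : y ∈ ({a, b, z} : Finset ℕ) := by rw [← e]; simp
  simp at this
  tauto

theorem PS.ne {v : ℕ} {B : Finset (Finset ℕ)} (h : PS v B) {a b y : ℕ}
    (h1 : ({a, b, y} : Finset ℕ) ∈ B) : a ≠ b ∧ a ≠ y ∧ b ≠ y := by
  have := (h.1 _ h1).2
  have h3 := Finset.card_eq_three.1 this
  refine ⟨?_, ?_, ?_⟩
  · rintro rfl
    have h3 := Finset.card_le_two (a := a) (b := y)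
    simp at this
    omega
  · rintro rfl
    have h3 := Finset.card_le_two (a := a) (b := b)
    rw [show ({a, b, a} : Finset ℕ) = {a, b} by ext; simp; tauto] at this
    omega
  · rintro rfl
    have h3 := Finset.card_le_two (a := a) (b := b)
    simp at this
    omega

theorem swap12 (a b c : ℕ) : ({a, b, c} : Finset ℕ) = {b, a, c} := by ext; simp; tauto
theorem swap23 (a b c : ℕ) : ({a, b, c} : Finset ℕ) = {a, c, b} := by ext; simp; tauto

theorem third_card {v : ℕ} {B : Finset (Finset ℕ)} (h : PS v B) (a b : ℕ) :
    (third v B a b).card ≤ 1 := by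
  rw [Finset.card_le_one]
  intro y hy z hz
  simp only [third, Finset.mem_filter] at hy hz
  exact h.2 a b y z hy.2 hz.2

theorem prs_card (l : ℕ) : 2 * (prs l).card = (l - 1) * (l - 1 - 1) := by
  unfold prs
  rw [Finset.card_sigma]
  simp only [Finset.card_range]
  rw [mul_comm, Finset.sum_range_id_mul_two]

theorem mem_prs {l i j : ℕ} : (⟨j, i⟩ : Σ _ : ℕ, ℕ) ∈ prs l ↔ i < j ∧ j < l - 1 := by
  simp [prs]; tauto

/-- Greedy count. -/
theorem forb_card_left {v l : ℕ} {B : Finset (Finset ℕ)} (h : PS v B) (P : Finset ℕ) (f : ℕ → ℕ)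
    (p : ℕ) (hp : ∀ q ∈ P, q < p) : (forb v l B P f p).card ≤ (prs l).card := by
  classical
  have hs : forb v l B P f p ⊆ (prs l).biUnion
      (fun s => third v B (f (p - 1 - s.1)) (f (p - 1 - s.2))) := by
    intro y hy
    simp only [forb, Finset.mem_filter] at hy
    obtain ⟨hyX, q, hq, r, hr, h1, h2, h3, hb⟩ := hy
    have hne : q ≠ r := by
      rintro rfl; exact (h.ne hb).1 rfl
    have := hp q hq
    have := hp r hr
    obtain ⟨h11, h12⟩ := h1
    obtain ⟨h21, h22⟩ := h2
    simp only [Finset.mem_biUnion]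
    rcases lt_or_gt_of_ne hne with hlt | hlt
    · refine ⟨⟨p - 1 - q, p - 1 - r⟩, mem_prs.2 (by omega), ?_⟩
      simp only [third, Finset.mem_filter]
      rw [show p - 1 - (p - 1 - q) = q by omega, show p - 1 - (p - 1 - r) = r by omega]
      exact ⟨hyX, hb⟩
    · refine ⟨⟨p - 1 - r, p - 1 - q⟩, mem_prs.2 (by omega), ?_⟩
      simp only [third, Finset.mem_filter]
      rw [show p - 1 - (p - 1 - q) = q by omega, show p - 1 - (p - 1 - r) = r by omega, swap12]
      exact ⟨hyX, hb⟩
  refine (Finset.card_le_card hs).trans ?_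
  have := Finset.card_biUnion_le_card_mul (prs l)
    (fun s => third v B (f (p - 1 - s.1)) (f (p - 1 - s.2))) 1 (fun s _ => third_card h _ _)
  omega

/-- Count for a hole. -/
theorem forb_card_hole {v l : ℕ} {B : Finset (Finset ℕ)} (h : PS v B) (P : Finset ℕ) (f : ℕ → ℕ)
    (p : ℕ) (hp : p ∉ P) : (forb v l B P f p).card ≤ 3 * (prs l).card := by
  classical
  set T : (Σ _ : ℕ, ℕ) → Finset ℕ := fun s =>
    third v B (f (p - 1 - s.1)) (f (p - 1 - s.2)) ∪
    (third v B (f (p + 1 + s.1)) (f (p + 1 + s.2)) ∪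
     third v B (f (p - 1 - s.2)) (f (p + (s.1 - s.2)))) with hT
  have hs : forb v l B P f p ⊆ (prs l).biUnion T := by
    intro y hy
    simp only [forb, Finset.mem_filter] at hy
    obtain ⟨hyX, q, hq, r, hr, h1, h2, h3, hb⟩ := hy
    have hne : q ≠ r := by
      rintro rfl; exact (h.ne hb).1 rfl
    have hqp : q ≠ p := by rintro rfl; exact hp hq
    have hrp : r ≠ p := by rintro rfl; exact hp hr
    clear hq hr
    wlog hlt : q < r generalizing q r
    · exact this r q h2 h1 (near_symm h3) (by rw [swap12]; exact hb) hne.symm hrp hqp (by omega)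
    obtain ⟨h11, h12⟩ := h1
    obtain ⟨h21, h22⟩ := h2
    obtain ⟨h31, h32⟩ := h3
    simp only [Finset.mem_biUnion, hT, Finset.mem_union, third, Finset.mem_filter]
    rcases lt_or_gt_of_ne hqp with hq | hq
    · rcases lt_or_gt_of_ne hrp with hr | hr
      · refine ⟨⟨p - 1 - q, p - 1 - r⟩, mem_prs.2 (by omega), Or.inl ?_⟩
        simp only
        rw [show p - 1 - (p - 1 - q) = q by omega, show p - 1 - (p - 1 - r) = r by omega]
        exact ⟨hyX, hb⟩
      · refine ⟨⟨r - q - 1, p - 1 - q⟩, mem_prs.2 (by omega), Or.inr (Or.inr ?_)⟩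
        simp only
        rw [show p - 1 - (p - 1 - q) = q by omega,
          show p + (r - q - 1 - (p - 1 - q)) = r by omega]
        exact ⟨hyX, hb⟩
    · refine ⟨⟨r - 1 - p, q - 1 - p⟩, mem_prs.2 (by omega), Or.inr (Or.inl ?_)⟩
      simp only
      rw [show p + 1 + (r - 1 - p) = r by omega, show p + 1 + (q - 1 - p) = q by omega, swap12]
      exact ⟨hyX, hb⟩
  refine (Finset.card_le_card hs).trans ?_
  have := Finset.card_biUnion_le_card_mul (prs l) T 3 (fun s _ => by
    have a1 := third_card h (f (p - 1 - s.1)) (f (p - 1 - s.2))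
    have a2 := third_card h (f (p + 1 + s.1)) (f (p + 1 + s.2))
    have a3 := third_card h (f (p - 1 - s.2)) (f (p + (s.1 - s.2)))
    refine (Finset.card_union_le _ _).trans ?_
    have := Finset.card_union_le (third v B (f (p + 1 + s.1)) (f (p + 1 + s.2)))
      (third v B (f (p - 1 - s.2)) (f (p + (s.1 - s.2))))
    omega)
  omega

/-- Extension by one position. -/
theorem GoodP.ext {v l : ℕ} {B : Finset (Finset ℕ)} (h : PS v B) {P : Finset ℕ} {f : ℕ → ℕ}
    (hg : GoodP v l B P f) {p y : ℕ} (hp : p ∉ P) (hy : y ∈ Finset.Icc 1 v)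
    (hyP : y ∉ P.image f) (hf : y ∉ forb v l B P f p) :
    GoodP v l B (insert p P) (Function.update f p y) := by
  obtain ⟨g1, g2, g3⟩ := hg
  have hq : ∀ q ∈ P, Function.update f p y q = f q := by
    intro q hq
    rw [Function.update_of_ne]
    rintro rfl; exact hp hq
  have hpp : Function.update f p y p = y := Function.update_self ..
  have hf' : ∀ q ∈ P, ∀ r ∈ P, near l p q → near l p r → near l q r →
      ({f q, f r, y} : Finset ℕ) ∉ B := by
    intro q hq r hr a b c d
    apply hf
    simp only [forb, Finset.mem_filter]
    exact ⟨hy, q, hq, r, hr, a, b, c, d⟩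
  have hyP' : ∀ q ∈ P, f q ≠ y := by
    intro q hq e; exact hyP (Finset.mem_image.2 ⟨q, hq, e⟩)
  refine ⟨?_, ?_, ?_⟩
  · intro a ha0 b hb0 e
    rcases Finset.mem_insert.1 ha0 with rfl | ha
    · rcases Finset.mem_insert.1 hb0 with rfl | hb
      · rfl
      · rw [hpp, hq _ hb] at e; exact absurd e.symm (hyP' _ hb)
    · rcases Finset.mem_insert.1 hb0 with rfl | hb
      · rw [hpp, hq _ ha] at e; exact absurd e (hyP' _ ha)
      · rw [hq _ ha, hq _ hb] at e; exact g1 _ ha _ hb e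
  · intro a ha0
    rcases Finset.mem_insert.1 ha0 with rfl | ha
    · rwa [hpp]
    · rw [hq _ ha]; exact g2 _ ha
  · intro a ha0 b hb0 c hc0 n1 n2 n3 hB
    have hn := h.ne hB
    rcases Finset.mem_insert.1 ha0 with rfl | ha
    · rcases Finset.mem_insert.1 hb0 with rfl | hb
      · exact hn.1 rfl
      rcases Finset.mem_insert.1 hc0 with rfl | hc
      · exact hn.2.1 rfl
      rw [hpp, hq _ hb, hq _ hc, swap12, swap23] at hB
      exact hf' b hb c hc n1 n2 n3 hB
    rcases Finset.mem_insert.1 hb0 with rfl | hb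
    · rcases Finset.mem_insert.1 hc0 with rfl | hc
      · exact hn.2.2 rfl
      rw [hpp, hq _ ha, hq _ hc, swap23] at hB
      exact hf' a ha c hc (near_symm n1) n3 n2 hB
    rcases Finset.mem_insert.1 hc0 with rfl | hc
    · rw [hpp, hq _ ha, hq _ hb] at hB
      exact hf' a ha b hb (near_symm n2) (near_symm n3) n1 hB
    rw [hq _ ha, hq _ hb, hq _ hc] at hB
    exact g3 a ha b hb c hc n1 n2 n3 hB

/-- One greedy step, avoiding an extra set `E`. -/
theorem GoodP.step {v l : ℕ} {B : Finset (Finset ℕ)} (h : PS v B) {P : Finset ℕ} {f : ℕ → ℕ}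
    (hg : GoodP v l B P f) (p : ℕ) (hp : ∀ q ∈ P, q < p) (E : Finset ℕ)
    (hc : P.card + (prs l).card + E.card < v) :
    ∃ y, y ∉ E ∧ y ∉ P.image f ∧ GoodP v l B (insert p P) (Function.update f p y) := by
  classical
  have h1 := forb_card_left (l := l) h P f p hp
  have h2 : (P.image f).card ≤ P.card := Finset.card_image_le
  have h3 : (P.image f ∪ (forb v l B P f p ∪ E)).card < (Finset.Icc 1 v).card := by
    have a1 := Finset.card_union_le (P.image f) (forb v l B P f p ∪ E)
    have a2 := Finset.card_union_le (forb v l B P f p) E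
    rw [Nat.card_Icc]
    omega
  obtain ⟨y, hy, hyn⟩ := Finset.exists_mem_notMem_of_card_lt_card h3
  simp only [Finset.mem_union, not_or] at hyn
  refine ⟨y, hyn.2.2, hyn.1, hg.ext h (fun hh => lt_irrefl _ (hp p hh)) hy hyn.1 hyn.2.1⟩

/-- Greedy extension by a set of positions. -/
theorem GoodP.greedy {v l : ℕ} {B : Finset (Finset ℕ)} (h : PS v B) {P : Finset ℕ} {f : ℕ → ℕ}
    (hg : GoodP v l B P f) (Q : Finset ℕ) :
    (∀ p ∈ P, ∀ q ∈ Q, p < q) → P.card + Q.card + (prs l).card ≤ v →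
    ∃ f', (∀ p ∈ P, f' p = f p) ∧ GoodP v l B (P ∪ Q) f' := by
  classical
  induction Q using Finset.induction_on_max with
  | empty => intro _ _; exact ⟨f, fun _ _ => rfl, by simpa using hg⟩
  | insert a s hs ih =>
    intro h1 h2
    have has : a ∉ s := fun hh => lt_irrefl _ (hs a hh)
    rw [Finset.card_insert_of_notMem has] at h2
    obtain ⟨f', e, g⟩ := ih (fun p hp q hq => h1 p hp q (Finset.mem_insert_of_mem hq)) (by omega)
    have hcu := Finset.card_union_le P s
    obtain ⟨y, -, -, gy⟩ := g.step h a (by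
      intro q hq
      rcases Finset.mem_union.1 hq with hq | hq
      · exact h1 q hq a (Finset.mem_insert_self _ _)
      · exact hs q hq) ∅ (by simp; omega)
    refine ⟨_, ?_, by rw [Finset.union_insert]; exact gy⟩
    intro p hp
    rw [Function.update_of_ne, e p hp]
    exact (h1 p hp a (Finset.mem_insert_self _ _)).ne

theorem GoodP.empty (v l : ℕ) (B : Finset (Finset ℕ)) : GoodP v l B ∅ id := by
  refine ⟨?_, ?_, ?_⟩ <;> simp

/-- Conclude from a complete good partial sequencing. -/
theorem finish {v l : ℕ} {B : Finset (Finset ℕ)} (h : PS v B) {f : ℕ → ℕ}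
    (hg : GoodP v l B (Finset.range v) f) : IsGoodSeq v l B (fun i => f (i - 1)) := by
  classical
  obtain ⟨g1, g2, g3⟩ := hg
  have hm : Set.MapsTo (fun i => f (i - 1)) (Finset.Icc 1 v) (Finset.Icc 1 v) := by
    intro i hi
    simp only [Finset.coe_Icc, Set.mem_Icc] at hi
    exact g2 _ (by simp; omega)
  have hi : Set.InjOn (fun i => f (i - 1)) (Finset.Icc 1 v) := by
    intro i hi j hj e
    simp only [Finset.coe_Icc, Set.mem_Icc] at hi hj
    have := g1 (i - 1) (by simp; omega) (j - 1) (by simp; omega) e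
    omega
  refine ⟨?_, ?_⟩
  · have hs := Finset.surjOn_of_injOn_of_card_le (s := Finset.Icc 1 v) (t := Finset.Icc 1 v)
      (fun i => f (i - 1)) hm hi le_rfl
    have : Set.BijOn (fun i => f (i - 1)) (Finset.Icc 1 v : Finset ℕ) (Finset.Icc 1 v : Finset ℕ) :=
      ⟨hm, hi, hs⟩
    simpa using this
  · intro i hi b hb hsub
    obtain ⟨a, c, d, -, -, -, rfl⟩ := Finset.card_eq_three.1 (h.1 b hb).2
    obtain ⟨p, ⟨hp1, hp2⟩, rfl⟩ := hsub (show a ∈ _ by simp)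
    obtain ⟨q, ⟨hq1, hq2⟩, rfl⟩ := hsub (show c ∈ _ by simp)
    obtain ⟨r, ⟨hr1, hr2⟩, rfl⟩ := hsub (show d ∈ _ by simp)
    simp only [Set.mem_Icc] at *
    refine g3 (p - 1) (by simp; omega) (q - 1) (by simp; omega) (r - 1) (by simp; omega)
      ?_ ?_ ?_ hb <;> constructor <;> omega

theorem fillers {v l : ℕ} {B : Finset (Finset ℕ)} (h : PS v B) {P : Finset ℕ} {f : ℕ → ℕ}
    (hl : 3 ≤ l) (hg : GoodP v l B P f) (n : ℕ) (hn : ∀ p ∈ P, p < n) (y : ℕ)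
    (hyP : y ∉ P.image f)
    (hc : P.card + (l - 2) + (prs l).card + (l - 1) ≤ v) :
    ∀ s, s ≤ l - 2 → ∃ f', (∀ p ∈ P, f' p = f p) ∧ GoodP v l B (P ∪ Finset.Ico n (n + s)) f' ∧
      y ∉ (P ∪ Finset.Ico n (n + s)).image f' ∧
      ∀ q ∈ P ∪ Finset.Ico n (n + s), ∀ r ∈ P ∪ Finset.Ico n (n + s), n ≤ q + 1 → n ≤ r + 1 →
        ({f' q, f' r, y} : Finset ℕ) ∉ B := by
  classical
  intro s
  induction s with
  | zero =>
    intro _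
    refine ⟨f, fun _ _ => rfl, by simpa using hg, by simpa using hyP, ?_⟩
    intro q hq r hr h1 h2 hb
    simp only [add_zero, Finset.Ico_self, Finset.union_empty] at hq hr
    have := hn q hq
    have := hn r hr
    have : q = r := by omega
    subst this
    exact (h.ne hb).1 rfl
  | succ s ih =>
    intro hs
    obtain ⟨f', e, g, hy', hB⟩ := ih (by omega)
    set E : Finset ℕ := insert y ((Finset.Ico (n - 1) (n + s)).biUnion
      (fun q => third v B (f' q) y)) with hE
    have hEc : E.card ≤ l - 1 := by
      have a1 := Finset.card_insert_le y ((Finset.Ico (n - 1) (n + s)).biUnion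
        (fun q => third v B (f' q) y))
      have a2 := Finset.card_biUnion_le_card_mul (Finset.Ico (n - 1) (n + s))
        (fun q => third v B (f' q) y) 1 (fun q _ => third_card h _ _)
      rw [Nat.card_Ico] at a2
      refine a1.trans ?_
      omega
    have hPc : (P ∪ Finset.Ico n (n + s)).card ≤ P.card + s := by
      have := Finset.card_union_le P (Finset.Ico n (n + s))
      rw [Nat.card_Ico] at this
      omega
    have hlt : ∀ q ∈ P ∪ Finset.Ico n (n + s), q < n + s := by
      intro q hq
      rcases Finset.mem_union.1 hq with hq | hq
      · have := hn q hq; omega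
      · exact (Finset.mem_Ico.1 hq).2
    obtain ⟨w, hwE, hwP, gw⟩ := g.step h (n + s) hlt E (by omega)
    have hPe : P ∪ Finset.Ico n (n + (s + 1)) = insert (n + s) (P ∪ Finset.Ico n (n + s)) := by
      ext x; simp only [Finset.mem_union, Finset.mem_Ico, Finset.mem_insert]
      constructor
      · rintro (h | h)
        · tauto
        · by_cases hx : x = n + s
          · tauto
          · right; right; omega
      · rintro (h | h | h)
        · right; omega
        · tauto
        · right; omega
    have hup : ∀ q ∈ P ∪ Finset.Ico n (n + s), Function.update f' (n + s) w q = f' q := by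
      intro q hq
      rw [Function.update_of_ne]
      exact (hlt q hq).ne
    have hus : Function.update f' (n + s) w (n + s) = w := Function.update_self ..
    have hwX : w ∈ Finset.Icc 1 v := by
      have := gw.2.1 (n + s) (Finset.mem_insert_self _ _)
      rwa [hus] at this
    have hkey : ∀ q ∈ P ∪ Finset.Ico n (n + s), n ≤ q + 1 → ({f' q, w, y} : Finset ℕ) ∉ B := by
      intro q hq h1 hb
      apply hwE
      rw [hE, Finset.mem_insert, Finset.mem_biUnion]
      right
      refine ⟨q, ?_, ?_⟩
      · have := hlt q hq
        rw [Finset.mem_Ico]; omega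
      · simp only [third, Finset.mem_filter]
        rw [swap23]
        exact ⟨hwX, hb⟩
    rw [hPe]
    refine ⟨_, ?_, gw, ?_, ?_⟩
    · intro p hp
      rw [hup p (Finset.mem_union_left _ hp), e p hp]
    · intro hh
      obtain ⟨q, hq0, hqy⟩ := Finset.mem_image.1 hh
      rcases Finset.mem_insert.1 hq0 with rfl | hq
      · rw [hus] at hqy
        apply hwE; rw [hE, hqy]; exact Finset.mem_insert_self _ _
      · rw [hup q hq] at hqy
        exact hy' (Finset.mem_image.2 ⟨q, hq, hqy⟩)
    · intro q hq0 r hr0 h1 h2 hb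
      rcases Finset.mem_insert.1 hq0 with rfl | hq
      · rcases Finset.mem_insert.1 hr0 with rfl | hr
        · exact (h.ne hb).1 rfl
        · rw [hus, hup r hr, swap12] at hb
          exact hkey r hr h2 hb
      · rcases Finset.mem_insert.1 hr0 with rfl | hr
        · rw [hus, hup q hq] at hb
          exact hkey q hq h1 hb
        · rw [hup q hq, hup r hr] at hb
          exact hB q hq r hr h1 h2 hb

theorem placeOne {v l : ℕ} {B : Finset (Finset ℕ)} (h : PS v B) {P : Finset ℕ} {f : ℕ → ℕ}
    (hl : 3 ≤ l) (hg : GoodP v l B P f) (n : ℕ) (hn : ∀ p ∈ P, p < n) (y : ℕ)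
    (hyX : y ∈ Finset.Icc 1 v) (hyP : y ∉ P.image f)
    (hc : P.card + (l - 2) + (prs l).card + (l - 1) ≤ v) :
    ∃ f', (∀ p ∈ P, f' p = f p) ∧ GoodP v l B (P ∪ Finset.Ico n (n + (l - 1))) f' ∧
      y ∈ (P ∪ Finset.Ico n (n + (l - 1))).image f' := by
  classical
  obtain ⟨f', e, g, hy', hB⟩ := fillers h hl hg n hn y hyP hc (l - 2) le_rfl
  have hlt : ∀ q ∈ P ∪ Finset.Ico n (n + (l - 2)), q < n + (l - 2) := by
    intro q hq
    rcases Finset.mem_union.1 hq with hq | hq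
    · have := hn q hq; omega
    · exact (Finset.mem_Ico.1 hq).2
  have hPe : P ∪ Finset.Ico n (n + (l - 1)) =
      insert (n + (l - 2)) (P ∪ Finset.Ico n (n + (l - 2))) := by
    ext x; simp only [Finset.mem_union, Finset.mem_Ico, Finset.mem_insert]
    constructor
    · rintro (h | h)
      · tauto
      · by_cases hx : x = n + (l - 2)
        · tauto
        · right; right; omega
    · rintro (h | h | h)
      · right; omega
      · tauto
      · right; omega
  have gx := g.ext h (p := n + (l - 2)) (y := y) (fun hh => lt_irrefl _ (hlt _ hh)) hyX hy' (by
    intro hf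
    simp only [forb, Finset.mem_filter] at hf
    obtain ⟨-, q, hq, r, hr, ⟨a1, a2⟩, ⟨b1, b2⟩, -, hb⟩ := hf
    exact hB q hq r hr (by omega) (by omega) hb)
  rw [hPe]
  refine ⟨_, ?_, gx, ?_⟩
  · intro p hp
    rw [Function.update_of_ne, e p hp]
    exact (hlt p (Finset.mem_union_left _ hp)).ne
  · exact Finset.mem_image.2 ⟨n + (l - 2), Finset.mem_insert_self _ _, Function.update_self ..⟩

theorem coverAll {v l m : ℕ} {B : Finset (Finset ℕ)} (h : PS v B) (hl : 3 ≤ l)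
    (hm : (prs l).card + l ≤ m) (D : Finset ℕ) : D ⊆ Finset.Icc 1 v →
    ∀ (P : Finset ℕ) (f : ℕ → ℕ) (n : ℕ), GoodP v l B P f → (∀ p ∈ P, p < n) →
    P.card + D.card * (l - 1) + m ≤ v →
    ∃ n' f', n ≤ n' ∧ (∀ p ∈ P, f' p = f p) ∧ GoodP v l B (P ∪ Finset.Ico n n') f' ∧
      D ⊆ (P ∪ Finset.Ico n n').image f' ∧ P.card + (n' - n) + m ≤ v := by
  classical
  induction D using Finset.induction_on with
  | empty =>
    intro _ P f n hg hn hc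
    exact ⟨n, f, le_rfl, fun _ _ => rfl, by simpa using hg, by simp, by simp at hc; omega⟩
  | insert y D hyD ih =>
    intro hD P f n hg hn hc
    have hyX := hD (Finset.mem_insert_self _ _)
    have hD' : D ⊆ Finset.Icc 1 v := fun x hx => hD (Finset.mem_insert_of_mem hx)
    rw [Finset.card_insert_of_notMem hyD, add_mul, one_mul] at hc
    by_cases hyP : y ∈ P.image f
    · obtain ⟨n', f', a, b, c, d, e⟩ := ih hD' P f n hg hn (by omega)
      refine ⟨n', f', a, b, c, ?_, e⟩
      intro x hx
      rcases Finset.mem_insert.1 hx with rfl | hx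
      · obtain ⟨p, hp, hpe⟩ := Finset.mem_image.1 hyP
        exact Finset.mem_image.2 ⟨p, Finset.mem_union_left _ hp, by rw [b p hp, hpe]⟩
      · exact d hx
    · obtain ⟨f1, e1, g1, hy1⟩ := placeOne h hl hg n hn y hyX hyP (by omega)
      have hdis : Disjoint P (Finset.Ico n (n + (l - 1))) := by
        rw [Finset.disjoint_left]
        intro p hp hp2
        have := hn p hp
        have := (Finset.mem_Ico.1 hp2).1
        omega
      have hcard : (P ∪ Finset.Ico n (n + (l - 1))).card = P.card + (l - 1) := by
        rw [Finset.card_union_of_disjoint hdis, Nat.card_Ico]; omega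
      obtain ⟨n', f', a, b, c, d, e⟩ := ih hD' _ f1 (n + (l - 1)) g1 (by
        intro q hq
        rcases Finset.mem_union.1 hq with hq | hq
        · have := hn q hq; omega
        · exact (Finset.mem_Ico.1 hq).2) (by omega)
      have hPP : P ∪ Finset.Ico n (n + (l - 1)) ∪ Finset.Ico (n + (l - 1)) n' =
          P ∪ Finset.Ico n n' := by
        rw [Finset.union_assoc, Finset.Ico_union_Ico_eq_Ico (by omega) a]
      rw [hPP] at c d
      refine ⟨n', f', by omega, ?_, c, ?_, by omega⟩
      · intro p hp
        rw [b p (Finset.mem_union_left _ hp), e1 p hp]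
      · intro x hx
        rcases Finset.mem_insert.1 hx with rfl | hx
        · obtain ⟨p, hp, hpe⟩ := Finset.mem_image.1 hy1
          refine Finset.mem_image.2 ⟨p, ?_, by rw [b p hp, hpe]⟩
          rw [← hPP]; exact Finset.mem_union_left _ hp
        · exact d hx

theorem mainBig {v l m : ℕ} {B : Finset (Finset ℕ)} (h : PS v B) (hl : 3 ≤ l)
    (hm : m + 1 = 6 * (prs l).card) (hm2 : (prs l).card + l ≤ m) (hv : m * (2 * l - 1) ≤ v) :
    ∃ f, GoodP v l B (Finset.range v) f := by
  classical
  set c := (prs l).card with hc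
  have hmul : m * (2 * l - 1) = m * (l - 1) + m * (l - 1) + m := by
    obtain ⟨t, rfl⟩ : ∃ t, l = t + 1 := ⟨l - 1, by omega⟩
    rw [show 2 * (t + 1) - 1 = 2 * t + 1 by omega, show t + 1 - 1 = t by omega]; ring
  have hml : m * l = m * (l - 1) + m := by
    obtain ⟨t, rfl⟩ : ∃ t, l = t + 1 := ⟨l - 1, by omega⟩
    rw [show t + 1 - 1 = t by omega]; ring
  set H := (Finset.range m).image (fun k => k * l) with hH
  have hHm : ∀ k, k < m → k * l < m * l := fun k hk => Nat.mul_lt_mul_of_pos_right hk (by omega)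
  have hHs : H ⊆ Finset.range (m * l) := by
    intro x hx
    obtain ⟨k, hk, rfl⟩ := Finset.mem_image.1 hx
    exact Finset.mem_range.2 (hHm k (Finset.mem_range.1 hk))
  have hHc : H.card = m := by
    rw [hH, Finset.card_image_of_injective, Finset.card_range]
    intro a b e
    exact Nat.eq_of_mul_eq_mul_right (by omega) e
  set P1 := Finset.range (m * l) \ H with hP1
  have hP1c : P1.card = m * (l - 1) := by
    rw [hP1, Finset.card_sdiff_of_subset hHs, hHc, Finset.card_range]; omega
  have hP1lt : ∀ p ∈ P1, p < m * l := fun p hp =>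
    Finset.mem_range.1 (Finset.mem_sdiff.1 hp).1
  -- phase 1
  obtain ⟨f1, -, g1⟩ := (GoodP.empty v l B).greedy h P1 (by simp) (by simp; omega)
  rw [Finset.empty_union] at g1
  -- bad points
  set Bad : Fin m → Finset ℕ := fun k => forb v l B P1 f1 (k * l) with hBad
  have hBadc : ∀ k, (Bad k).card ≤ 3 * c := by
    intro k
    apply forb_card_hole h
    intro hh
    exact (Finset.mem_sdiff.1 hh).2 (Finset.mem_image.2 ⟨k, Finset.mem_range.2 k.2, rfl⟩)
  set D := (Finset.Icc 1 v).filter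
    (fun y => 3 * c ≤ (Finset.univ.filter (fun k : Fin m => y ∈ Bad k)).card) with hD
  have hDc : D.card ≤ m := by
    have := Finset.card_mul_le_card_mul (s := D) (t := (Finset.univ : Finset (Fin m)))
      (fun y k => y ∈ Bad k) (m := 3 * c) (n := 3 * c)
      (fun y hy => (Finset.mem_filter.1 hy).2)
      (fun k _ => by
        refine le_trans (Finset.card_le_card ?_) (hBadc k)
        intro y hy
        exact (Finset.mem_filter.1 hy).2)
    rw [Finset.card_univ, Fintype.card_fin] at this
    exact Nat.le_of_mul_le_mul_right this (by omega)
  -- phase 2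
  obtain ⟨n, f2, hn, e2, g2, hD2, hcn⟩ := coverAll h hl hm2 D (Finset.filter_subset _ _) P1 f1
    (m * l) g1 hP1lt (by
      have := Nat.mul_le_mul_right (l - 1) hDc
      omega)
  -- phase 3
  have hdis : ∀ N, Disjoint P1 (Finset.Ico (m * l) N) := by
    intro N
    rw [Finset.disjoint_left]
    intro p hp hp2
    have := hP1lt p hp
    have := (Finset.mem_Ico.1 hp2).1
    omega
  have hnv : n ≤ v := by omega
  obtain ⟨f3, e3, g3⟩ := g2.greedy h (Finset.Ico n v) (by
      intro p hp q hq
      have h2 := (Finset.mem_Ico.1 hq).1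
      rcases Finset.mem_union.1 hp with hp | hp
      · have := hP1lt p hp; omega
      · have := (Finset.mem_Ico.1 hp).2; omega) (by
      rw [Finset.card_union_of_disjoint (hdis n), Nat.card_Ico, Nat.card_Ico]
      omega)
  rw [Finset.union_assoc, Finset.Ico_union_Ico_eq_Ico hn hnv] at g3
  set P3 := P1 ∪ Finset.Ico (m * l) v with hP3
  have hP3c : P3.card + m = v := by
    rw [hP3, Finset.card_union_of_disjoint (hdis v), Nat.card_Ico]; omega
  have e31 : ∀ p ∈ P1, f3 p = f1 p := fun p hp => by
    rw [e3 p (Finset.mem_union_left _ hp), e2 p hp]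
  have hD3 : ∀ y ∈ D, y ∈ P3.image f3 := by
    intro y hy
    obtain ⟨p, hp, hpe⟩ := Finset.mem_image.1 (hD2 hy)
    refine Finset.mem_image.2 ⟨p, ?_, by rw [e3 p hp, hpe]⟩
    rcases Finset.mem_union.1 hp with hp | hp
    · exact Finset.mem_union_left _ hp
    · refine Finset.mem_union_right _ ?_
      have := Finset.mem_Ico.1 hp
      rw [Finset.mem_Ico]; omega
  -- phase 4
  set U := Finset.Icc 1 v \ P3.image f3 with hU
  have hUc : U.card = m := by
    rw [hU, Finset.card_sdiff_of_subset, Finset.card_image_of_injOn, Nat.card_Icc]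
    · omega
    · intro a ha b hb e
      exact g3.1 a ha b hb e
    · intro x hx
      obtain ⟨p, hp, rfl⟩ := Finset.mem_image.1 hx
      exact g3.2.1 p hp
  obtain ⟨g, ginj, hg⟩ := (Finset.all_card_le_biUnion_card_iff_exists_injective
    (fun k : Fin m => U \ Bad k)).1 (by
      intro S
      rcases S.eq_empty_or_nonempty with rfl | ⟨k, hk⟩
      · simp
      by_cases hS : S.card + 3 * c ≤ m
      · have h1 : (U \ Bad k).card ≤ (S.biUnion (fun k => U \ Bad k)).card :=
          Finset.card_le_card (Finset.subset_biUnion_of_mem (fun k => U \ Bad k) hk)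
        have h2 := Finset.le_card_sdiff (Bad k) U
        have h3 := hBadc k
        omega
      · have hSm : S.card ≤ m := by
          have := Finset.card_le_univ S
          rwa [Fintype.card_fin] at this
        have : U ⊆ S.biUnion (fun k => U \ Bad k) := by
          intro y hy
          by_contra hcon
          have hall : ∀ k ∈ S, y ∈ Bad k := by
            intro k hk
            by_contra hkb
            exact hcon (Finset.mem_biUnion.2 ⟨k, hk, Finset.mem_sdiff.2 ⟨hy, hkb⟩⟩)
          have hle : S.card ≤ (Finset.univ.filter (fun k : Fin m => y ∈ Bad k)).card :=
            Finset.card_le_card (fun k hk => Finset.mem_filter.2 ⟨Finset.mem_univ _, hall k hk⟩)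
          have hyU := Finset.mem_sdiff.1 hy
          exact hyU.2 (hD3 y (Finset.mem_filter.2 ⟨hyU.1, by omega⟩))
        have := Finset.card_le_card this
        omega)
  -- fill the holes
  have hfill : ∀ j, j ≤ m → ∃ f, (∀ p ∈ P3, f p = f3 p) ∧
      (∀ k : Fin m, (k : ℕ) < j → f (k * l) = g k) ∧
      GoodP v l B (P3 ∪ (Finset.range j).image (fun k => k * l)) f := by
    intro j
    induction j with
    | zero => intro _; exact ⟨f3, fun _ _ => rfl, by simp, by simpa using g3⟩
    | succ j ih =>
      intro hj
      obtain ⟨f, a1, a2, a3⟩ := ih (by omega)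
      set J : Fin m := ⟨j, by omega⟩ with hJ
      have hgJ := Finset.mem_sdiff.1 (hg J)
      have hgU := Finset.mem_sdiff.1 hgJ.1
      have hjlt : j * l < m * l := hHm j (by omega)
      have hjl : j * l + l ≤ m * l := by
        have := Nat.mul_le_mul_right l hj
        rw [add_mul, one_mul] at this
        exact this
      have hjP3 : j * l ∉ P3 := by
        intro hh
        rcases Finset.mem_union.1 hh with hh | hh
        · exact (Finset.mem_sdiff.1 hh).2
            (Finset.mem_image.2 ⟨j, Finset.mem_range.2 (by omega), rfl⟩)
        · have := (Finset.mem_Ico.1 hh).1; omega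
      have hjnot : j * l ∉ P3 ∪ (Finset.range j).image (fun k => k * l) := by
        intro hh
        rcases Finset.mem_union.1 hh with hh | hh
        · exact hjP3 hh
        · obtain ⟨k, hk, e⟩ := Finset.mem_image.1 hh
          have := Nat.eq_of_mul_eq_mul_right (by omega) e
          have := Finset.mem_range.1 hk
          omega
      have hnearP : ∀ q ∈ P3 ∪ (Finset.range j).image (fun k => k * l), near l (j * l) q →
          q ∈ P1 := by
        intro q hq hnr
        obtain ⟨n1, n2⟩ := hnr
        rcases Finset.mem_union.1 hq with hq | hq
        · rcases Finset.mem_union.1 hq with hq | hq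
          · exact hq
          · have := (Finset.mem_Ico.1 hq).1; omega
        · obtain ⟨k, hk, rfl⟩ := Finset.mem_image.1 hq
          have hk := Finset.mem_range.1 hk
          have := Nat.mul_le_mul_right l (show k + 1 ≤ j from hk)
          rw [add_mul, one_mul] at this
          omega
      have gx := a3.ext h hjnot hgU.1 (by
        intro hh
        obtain ⟨p, hp, e⟩ := Finset.mem_image.1 hh
        rcases Finset.mem_union.1 hp with hp | hp
        · rw [a1 p hp] at e
          exact hgU.2 (Finset.mem_image.2 ⟨p, hp, e⟩)
        · obtain ⟨k, hk, rfl⟩ := Finset.mem_image.1 hp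
          have hk := Finset.mem_range.1 hk
          have h1 := a2 ⟨k, by omega⟩ hk
          simp only at h1 e
          rw [h1] at e
          have := ginj e
          rw [hJ, Fin.mk.injEq] at this
          omega) (by
        intro hf
        apply hgJ.2
        simp only [hBad, forb, Finset.mem_filter] at hf ⊢
        obtain ⟨hX, q, hq, r, hr, b1, b2, b3, hb⟩ := hf
        have hq1 := hnearP q hq b1
        have hr1 := hnearP r hr b2
        refine ⟨hX, q, hq1, r, hr1, b1, b2, b3, ?_⟩
        rw [a1 q (Finset.mem_union_left _ hq1), a1 r (Finset.mem_union_left _ hr1),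
          e31 q hq1, e31 r hr1] at hb
        exact hb)
      refine ⟨Function.update f (j * l) (g J), ?_, ?_, ?_⟩
      rotate_left 2
      · rw [Finset.range_add_one, Finset.image_insert, Finset.union_insert]
        exact gx
      · intro p hp
        rw [Function.update_of_ne, a1 p hp]
        rintro rfl; exact hjP3 hp
      · intro k hk
        by_cases hkj : (k : ℕ) = j
        · have : k = J := Fin.ext hkj
          subst this
          exact Function.update_self ..
        · rw [Function.update_of_ne, a2 k (by omega)]
          intro e
          exact hkj (Nat.eq_of_mul_eq_mul_right (by omega) e)
  obtain ⟨f, -, -, gf⟩ := hfill m le_rfl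
  have : P3 ∪ (Finset.range m).image (fun k => k * l) = Finset.range v := by
    rw [← hH]
    have h1 : m * l ≤ v := by omega
    ext x
    simp only [hP3, hP1, Finset.mem_union, Finset.mem_sdiff, Finset.mem_range, Finset.mem_Ico]
    constructor
    · rintro ((h | h) | h)
      · omega
      · omega
      · have := Finset.mem_range.1 (hHs h); omega
    · intro hx
      by_cases hxH : x ∈ H
      · exact Or.inr hxH
      · left
        by_cases hxm : x < m * l
        · exact Or.inl ⟨hxm, hxH⟩
        · right; omega
  rw [this] at gf
  exact ⟨f, gf⟩

theorem step3 {v n : ℕ} {B : Finset (Finset ℕ)} (h : PS v B) {f : ℕ → ℕ}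
    (hg : GoodP v 3 B (Finset.range (n + 2)) f) {y : ℕ} (hy : y ∈ Finset.Icc 1 v)
    (hyP : y ∉ (Finset.range (n + 2)).image f) (hb : ({f n, f (n + 1), y} : Finset ℕ) ∉ B) :
    GoodP v 3 B (Finset.range (n + 3)) (Function.update f (n + 2) y) := by
  classical
  rw [show n + 3 = (n + 2) + 1 by omega, Finset.range_add_one]
  refine hg.ext h (by simp) hy hyP ?_
  intro hf
  simp only [forb, Finset.mem_filter, Finset.mem_range] at hf
  obtain ⟨-, q, hq, r, hr, ⟨n1, n2⟩, ⟨n3, n4⟩, -, hB⟩ := hf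
  have hne : q ≠ r := by rintro rfl; exact (h.ne hB).1 rfl
  have : (q = n ∧ r = n + 1) ∨ (r = n ∧ q = n + 1) := by omega
  rcases this with ⟨rfl, rfl⟩ | ⟨rfl, rfl⟩
  · exact hb hB
  · rw [swap12] at hB; exact hb hB

/-- Three remaining points which do not form a block can be appended. -/
theorem last3 {n : ℕ} {B : Finset (Finset ℕ)} (h : PS (n + 5) B) {f : ℕ → ℕ}
    (hg : GoodP (n + 5) 3 B (Finset.range (n + 2)) f) {p q r : ℕ}
    (hU : Finset.Icc 1 (n + 5) \ (Finset.range (n + 2)).image f = {p, q, r})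
    (hpq : p ≠ q) (hpr : p ≠ r) (hqr : q ≠ r)
    (h0 : ({p, q, r} : Finset ℕ) ∉ B) (h1 : ({f n, f (n + 1), p} : Finset ℕ) ∉ B)
    (h2 : ({f (n + 1), p, q} : Finset ℕ) ∉ B) :
    ∃ f, GoodP (n + 5) 3 B (Finset.range (n + 5)) f := by
  classical
  have hp : p ∈ Finset.Icc 1 (n + 5) \ (Finset.range (n + 2)).image f := by rw [hU]; simp
  have hq : q ∈ Finset.Icc 1 (n + 5) \ (Finset.range (n + 2)).image f := by rw [hU]; simp
  have hr : r ∈ Finset.Icc 1 (n + 5) \ (Finset.range (n + 2)).image f := by rw [hU]; simp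
  simp only [Finset.mem_sdiff] at hp hq hr
  have hne : ∀ z, z ∉ (Finset.range (n + 2)).image f → ∀ i, i < n + 2 → f i ≠ z := by
    intro z hz i hi e
    exact hz (Finset.mem_image.2 ⟨i, Finset.mem_range.2 hi, e⟩)
  have hq' := hne q hq.2
  have hr' := hne r hr.2
  have s1 := step3 h hg hp.1 hp.2 h1
  have s2 := step3 (n := n + 1) h s1 hq.1 (by
    intro hh
    obtain ⟨i, hi, e⟩ := Finset.mem_image.1 hh
    rw [Finset.mem_range] at hi
    by_cases hin : i = n + 2
    · subst hin; rw [Function.update_self] at e; exact hpq e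
    · rw [Function.update_of_ne hin] at e; exact hq' i (by omega) e) (by
    rw [show n + 1 + 1 = n + 2 by omega, Function.update_self, Function.update_of_ne (by omega)]
    exact h2)
  have s3 := step3 (n := n + 2) h s2 hr.1 (by
    intro hh
    obtain ⟨i, hi, e⟩ := Finset.mem_image.1 hh
    rw [Finset.mem_range] at hi
    by_cases hin : i = n + 1 + 2
    · subst hin; rw [Function.update_self] at e; exact hqr e
    rw [Function.update_of_ne hin] at e
    by_cases hin2 : i = n + 2
    · subst hin2; rw [Function.update_self] at e; exact hpr e
    · rw [Function.update_of_ne hin2] at e; exact hr' i (by omega) e) (by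
    rw [show n + 2 + 1 = n + 1 + 2 by omega, Function.update_self,
      Function.update_of_ne (by omega), Function.update_self]
    exact h0)
  exact ⟨_, s3⟩

theorem main3 {n : ℕ} {B : Finset (Finset ℕ)} (h : PS (n + 6) B) :
    ∃ f, GoodP (n + 6) 3 B (Finset.range (n + 6)) f := by
  classical
  have hp3 : (prs 3).card = 1 := by
    have := prs_card 3
    omega
  obtain ⟨f, -, g⟩ := (GoodP.empty (n + 6) 3 B).greedy h (Finset.range (n + 2)) (by simp)
    (by simp [hp3])
  rw [Finset.empty_union] at g
  have himg : ∀ (k : ℕ) (f : ℕ → ℕ), GoodP (n + 6) 3 B (Finset.range k) f → k ≤ n + 6 →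
      (Finset.Icc 1 (n + 6) \ (Finset.range k).image f).card = n + 6 - k := by
    intro k f g hk
    rw [Finset.card_sdiff_of_subset, Finset.card_image_of_injOn, Nat.card_Icc, Finset.card_range]
    · omega
    · intro a ha b hb e
      exact g.1 a ha b hb e
    · intro x hx
      obtain ⟨p, hp, rfl⟩ := Finset.mem_image.1 hx
      exact g.2.1 p hp
  set U := Finset.Icc 1 (n + 6) \ (Finset.range (n + 2)).image f with hU
  have hUc : U.card = 4 := by rw [himg _ _ g (by omega)]; omega
  -- choose the next point
  obtain ⟨y, hyU, hy1, hy2⟩ : ∃ y ∈ U, ({f n, f (n + 1), y} : Finset ℕ) ∉ B ∧ U.erase y ∉ B := by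
    by_contra hcon
    push Not at hcon
    set S1 := U.filter (fun y => ({f n, f (n + 1), y} : Finset ℕ) ∈ B) with hS1
    set S2 := U.filter (fun y => U.erase y ∈ B) with hS2
    have c1 : S1.card ≤ 1 := by
      rw [Finset.card_le_one]
      intro a ha b hb
      exact h.2 _ _ _ _ (Finset.mem_filter.1 ha).2 (Finset.mem_filter.1 hb).2
    have c2 : S2.card ≤ 1 := by
      rw [Finset.card_le_one]
      intro a ha b hb
      obtain ⟨haU, ha⟩ := Finset.mem_filter.1 ha
      obtain ⟨hbU, hb⟩ := Finset.mem_filter.1 hb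
      by_contra hab
      have hcard : ((U.erase a).erase b).card = 2 := by
        rw [Finset.card_erase_of_mem (Finset.mem_erase.2 ⟨Ne.symm hab, hbU⟩),
          Finset.card_erase_of_mem haU, hUc]
      obtain ⟨s, t, hst, he⟩ := Finset.card_eq_two.1 hcard
      have e1 : U.erase a = {s, t, b} := by
        rw [← Finset.insert_erase (Finset.mem_erase.2 ⟨Ne.symm hab, hbU⟩ : b ∈ U.erase a), he,
          swap12, swap23]
      have e2 : U.erase b = {s, t, a} := by
        rw [← Finset.insert_erase (Finset.mem_erase.2 ⟨hab, haU⟩ : a ∈ U.erase b),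
          Finset.erase_right_comm, he, swap12, swap23]
      rw [e1] at ha
      rw [e2] at hb
      exact hab (h.2 _ _ _ _ hb ha)
    have : U ⊆ S1 ∪ S2 := by
      intro y hy
      by_cases hb : ({f n, f (n + 1), y} : Finset ℕ) ∈ B
      · exact Finset.mem_union_left _ (Finset.mem_filter.2 ⟨hy, hb⟩)
      · exact Finset.mem_union_right _ (Finset.mem_filter.2 ⟨hy, hcon y hy hb⟩)
    have k1 := Finset.card_le_card this
    have k2 := Finset.card_union_le S1 S2
    omega
  have hyU' := Finset.mem_sdiff.1 hyU
  have s1 := step3 h g hyU'.1 hyU'.2 hy1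
  set F := Function.update f (n + 2) y with hF
  have hU3 : Finset.Icc 1 (n + 1 + 5) \ (Finset.range (n + 1 + 2)).image F = U.erase y := by
    rw [show n + 1 + 2 = n + 2 + 1 by omega, Finset.range_add_one, Finset.image_insert,
      show F (n + 2) = y from Function.update_self ..]
    have : (Finset.range (n + 2)).image F = (Finset.range (n + 2)).image f := by
      apply Finset.image_congr
      intro i hi
      have : i < n + 2 := by simpa using hi
      exact Function.update_of_ne (by omega) ..
    rw [this, hU]
    ext x
    simp only [Finset.mem_sdiff, Finset.mem_insert, Finset.mem_erase]
    tauto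
  have hc3 : (U.erase y).card = 3 := by rw [Finset.card_erase_of_mem hyU, hUc]
  obtain ⟨p, q, r, hpq, hpr, hqr, he⟩ := Finset.card_eq_three.1 hc3
  rw [he] at hU3 hy2
  -- `P a b c` : the order `a, b, c` works
  have key : ∀ a b c : ℕ, ({p, q, r} : Finset ℕ) = {a, b, c} → a ≠ b → a ≠ c → b ≠ c →
      ({F (n + 1), F (n + 1 + 1), a} : Finset ℕ) ∉ B → ({F (n + 1 + 1), a, b} : Finset ℕ) ∉ B →
      ∃ f, GoodP (n + 6) 3 B (Finset.range (n + 6)) f := by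
    intro a b c e h1 h2 h3 h4 h5
    exact last3 (n := n + 1) h s1 (hU3.trans e) h1 h2 h3 (by rw [← e]; exact hy2) h4 h5
  by_contra hno
  have k1 : ∀ a b c : ℕ, ({p, q, r} : Finset ℕ) = {a, b, c} → a ≠ b → a ≠ c → b ≠ c →
      ({F (n + 1), F (n + 1 + 1), a} : Finset ℕ) ∈ B := by
    intro a b c e h1 h2 h3
    by_contra h4
    have m1 : ({F (n + 1 + 1), a, b} : Finset ℕ) ∈ B := by
      by_contra h5; exact hno (key a b c e h1 h2 h3 h4 h5)
    have m2 : ({F (n + 1 + 1), a, c} : Finset ℕ) ∈ B := by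
      by_contra h5; exact hno (key a c b (by rw [e, swap23]) h2 h1 (Ne.symm h3) h4 h5)
    exact h3 (h.2 _ _ _ _ m1 m2)
  exact hpq (h.2 _ _ _ _ (k1 p q r rfl hpq hpr hqr)
    (k1 q p r (by rw [swap12]) (Ne.symm hpq) hqr hpr))

theorem numeric (ℓ v : ℕ) (hℓ : 4 ≤ ℓ)
    (hv : ((ℓ : ℚ) - 1) * ((ℓ : ℚ) ^ 5 - 9 * (ℓ : ℚ) ^ 3 + 20 * (ℓ : ℚ) ^ 2
      - 36 * (ℓ : ℚ) + 16) / 16 ≤ (v : ℚ)) :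
    (6 * (prs ℓ).card - 1) * (2 * ℓ - 1) ≤ v ∧ (prs ℓ).card + ℓ ≤ 6 * (prs ℓ).card - 1 := by
  have hp := prs_card ℓ
  obtain ⟨t, rfl⟩ : ∃ t, ℓ = t + 4 := ⟨ℓ - 4, by omega⟩
  rw [show t + 4 - 1 - 1 = t + 2 by omega, show t + 4 - 1 = t + 3 by omega] at hp
  have h6 : 6 * (prs (t + 4)).card - 1 = 3 * t ^ 2 + 15 * t + 17 := by
    have : 6 * (prs (t + 4)).card = 3 * ((t + 3) * (t + 2)) := by omega
    rw [this]
    have : 3 * ((t + 3) * (t + 2)) = 3 * t ^ 2 + 15 * t + 17 + 1 := by ring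
    omega
  refine ⟨?_, ?_⟩
  · rw [h6, show 2 * (t + 4) - 1 = 2 * t + 7 by omega]
    have : (((3 * t ^ 2 + 15 * t + 17) * (2 * t + 7) : ℕ) : ℚ) ≤ (v : ℚ) := by
      refine le_trans ?_ hv
      push_cast
      have ht : (0 : ℚ) ≤ t := by positivity
      rw [le_div_iff₀ (by norm_num), ← sub_nonneg]
      ring_nf
      positivity
    exact_mod_cast this
  · have : 2 * (prs (t + 4)).card = t ^ 2 + 5 * t + 6 := by rw [hp]; ring
    have : 0 ≤ t ^ 2 := by positivity
    omega

/-- For all integers `ℓ ≥ 3` and `v`, every Steiner triple system of order `v` with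
`v ≥ (ℓ−1)(ℓ^5 − 9ℓ^3 + 20ℓ^2 − 36ℓ + 16)/16` has an `ℓ`-good sequencing. -/
theorem sts_good_sequencing_of_large
    (ℓ v : ℕ) (hℓ : 3 ≤ ℓ) (B : Finset (Finset ℕ)) (hSTS : IsSTS v B)
    (hv : ((ℓ : ℚ) - 1) * ((ℓ : ℚ) ^ 5 - 9 * (ℓ : ℚ) ^ 3 + 20 * (ℓ : ℚ) ^ 2
      - 36 * (ℓ : ℚ) + 16) / 16 ≤ (v : ℚ)) :
    ∃ x : ℕ → ℕ, IsGoodSeq v ℓ B x := by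

  have hps := ps_of_sts hSTS
  rcases Nat.lt_or_ge ℓ 4 with h4 | h4
  · obtain rfl : ℓ = 3 := by omega
    have h11 : (11 : ℚ) ≤ v := by
      refine le_trans ?_ hv
      norm_num
    have h11' : 11 ≤ v := by exact_mod_cast h11
    obtain ⟨n, rfl⟩ : ∃ n, v = n + 6 := ⟨v - 6, by omega⟩
    obtain ⟨f, hf⟩ := main3 hps
    exact ⟨_, finish hps hf⟩
  · obtain ⟨h1, h2⟩ := numeric ℓ v h4 hv
    obtain ⟨f, hf⟩ := mainBig (m := 6 * (prs ℓ).card - 1) hps hℓ (by omega) h2 h1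
    exact ⟨_, finish hps hf⟩
end

section
/- No Steiner triple system of order 13 has a 5-good sequencing. -/
/-- Weight of an unordered pair of positions `0, …, 12` (Farkas certificate). -/
def pairWeight (i j : Fin 13) : ℤ :=
  if i = j then 0
  else if i.val = 6 then (if j.val ≤ 1 ∨ 11 ≤ j.val then -5 else 1)
  else if j.val = 6 then (if i.val ≤ 1 ∨ 11 ≤ i.val then -5 else 1)
  else if (i.val < 6 ∧ 6 < j.val) ∨ (j.val < 6 ∧ 6 < i.val) then -2
  else if i.val + 5 = j.val ∨ j.val + 5 = i.val then -8
  else 4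

/-- The three positions lie in a common window of length five. -/
def InWindow (i j k : Fin 13) : Prop :=
  ∃ a : Fin 13, (a ≤ i ∧ i.val ≤ a + 4) ∧ (a ≤ j ∧ j.val ≤ a + 4) ∧ (a ≤ k ∧ k.val ≤ a + 4)

instance (i j k : Fin 13) : Decidable (InWindow i j k) := by
  unfold InWindow; infer_instance

lemma pairWeight_symm : ∀ i j, pairWeight i j = pairWeight j i := by decide

set_option maxRecDepth 100000 in
set_option maxHeartbeats 4000000 in
lemma pairWeight_block : ∀ i j k : Fin 13, i ≠ j → i ≠ k → j ≠ k → ¬ InWindow i j k →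
    pairWeight i j + pairWeight j k + pairWeight i k ≤ 0 := by
  decide +kernel

lemma pairWeight_total : 0 < ∑ i, ∑ j, pairWeight i j := by decide +kernel

/-- Abstract form: a symmetric ternary relation describing the blocks. -/
lemma no_relation (R : Fin 13 → Fin 13 → Fin 13 → Prop)
    (h1 : ∀ i j k, R i j k → R j i k) (h2 : ∀ i j k, R i j k → R i k j)
    (hne : ∀ i j k, R i j k → i ≠ j)
    (hex : ∀ i j, i ≠ j → ∃! k, R i j k)
    (hw : ∀ i j k, R i j k → ¬ InWindow i j k) : False := by
  classical
  have e1 : ∑ i, ∑ j, ∑ k, (if R i j k then pairWeight i j else 0)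
      = ∑ i, ∑ j, pairWeight i j := by
    refine Finset.sum_congr rfl fun i _ => Finset.sum_congr rfl fun j _ => ?_
    by_cases hij : i = j
    · subst hij
      simp [pairWeight]
    · obtain ⟨k, hk, hu⟩ := hex i j hij
      rw [Finset.sum_eq_single k]
      · simp [hk]
      · intro b _ hb
        rw [if_neg]
        exact fun h => hb (hu b h)
      · simp
  have s1 : ∀ i j k, R i j k ↔ R j i k := fun i j k => ⟨h1 _ _ _, h1 _ _ _⟩
  have s2 : ∀ i j k, R i j k ↔ R i k j := fun i j k => ⟨h2 _ _ _, h2 _ _ _⟩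
  have e2 : ∑ i, ∑ j, ∑ k, (if R i j k then pairWeight i k else 0)
      = ∑ i, ∑ j, pairWeight i j := by
    rw [← e1]
    refine Finset.sum_congr rfl fun i _ => ?_
    rw [Finset.sum_comm]
    refine Finset.sum_congr rfl fun j _ => Finset.sum_congr rfl fun k _ => ?_
    simp only [s2 i k j]
  have e3 : ∑ i, ∑ j, ∑ k, (if R i j k then pairWeight j k else 0)
      = ∑ i, ∑ j, pairWeight i j := by
    rw [← e2, Finset.sum_comm]
    refine Finset.sum_congr rfl fun i _ => Finset.sum_congr rfl fun j _ =>
      Finset.sum_congr rfl fun k _ => ?_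
    simp only [s1 j i k]
  have key : ∑ i, ∑ j, ∑ k, ((if R i j k then pairWeight i j else 0)
      + (if R i j k then pairWeight j k else 0)
      + (if R i j k then pairWeight i k else 0)) ≤ 0 := by
    refine Finset.sum_nonpos fun i _ => Finset.sum_nonpos fun j _ =>
      Finset.sum_nonpos fun k _ => ?_
    by_cases h : R i j k
    · simp only [h, if_true]
      exact pairWeight_block i j k (hne _ _ _ h) (hne _ _ _ (h2 _ _ _ h))
        (hne j k i (h2 _ _ _ (h1 _ _ _ h))) (hw _ _ _ h)
    · simp [h]
  simp only [Finset.sum_add_distrib] at key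
  rw [e1, e2, e3] at key
  have := pairWeight_total
  linarith

/-- No Steiner triple system of order 13 has a 5-good sequencing. -/
theorem no_five_good_sequencing_of_sts_thirteen
    (B : Finset (Finset ℕ)) (hSTS : IsSTS 13 B) :
    ¬ ∃ x : ℕ → ℕ, IsGoodSeq 13 5 B x := by
  rintro ⟨x, ⟨hmaps, hinj, hsurj⟩, hgood⟩
  obtain ⟨hB, hpair⟩ := hSTS
  have mem : ∀ i : Fin 13, (i.val + 1) ∈ Set.Icc 1 13 := fun i => by
    have := i.isLt
    simp only [Set.mem_Icc]; omega
  let y : Fin 13 → ℕ := fun i => x (i.val + 1)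
  have yinj : Function.Injective y := fun i j h => by
    have := hinj (mem i) (mem j) h
    exact Fin.ext (by omega)
  have ymem : ∀ i, y i ∈ Finset.Icc 1 13 := fun i => by
    have := hmaps (mem i)
    simpa [y] using this
  have ysurj : ∀ n ∈ Finset.Icc 1 13, ∃ i, y i = n := fun n hn => by
    obtain ⟨m, hm, rfl⟩ := hsurj (show n ∈ Set.Icc 1 13 by simpa using hn)
    simp only [Set.mem_Icc] at hm
    refine ⟨⟨m - 1, by omega⟩, ?_⟩
    simp only [y]
    congr 1
    omega
  refine no_relation (fun i j k => i ≠ j ∧ i ≠ k ∧ j ≠ k ∧ ({y i, y j, y k} : Finset ℕ) ∈ B)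
    ?_ ?_ ?_ ?_ ?_
  · rintro i j k ⟨a, b, c, h⟩
    refine ⟨a.symm, c, b, ?_⟩
    rwa [Finset.insert_comm]
  · rintro i j k ⟨a, b, c, h⟩
    refine ⟨b, a, c.symm, ?_⟩
    rwa [Finset.pair_comm]
  · rintro i j k ⟨a, -⟩
    exact a
  · intro i j hij
    have hy : y i ≠ y j := fun h => hij (yinj h)
    obtain ⟨b, ⟨hb, hi, hj⟩, hu⟩ := hpair (y i) (ymem i) (y j) (ymem j) hy
    obtain ⟨hsub, hcard⟩ := hB b hb
    have hsub2 : ({y i, y j} : Finset ℕ) ⊆ b := by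
      intro z hz
      simp only [Finset.mem_insert, Finset.mem_singleton] at hz
      rcases hz with rfl | rfl <;> assumption
    have hc2 : ({y i, y j} : Finset ℕ).card = 2 := Finset.card_pair hy
    obtain ⟨z, hz, hz'⟩ : ∃ z ∈ b, z ∉ ({y i, y j} : Finset ℕ) :=
      Finset.exists_mem_notMem_of_card_lt_card (by omega)
    obtain ⟨k, rfl⟩ := ysurj z (hsub hz)
    simp only [Finset.mem_insert, Finset.mem_singleton, not_or] at hz'
    have hik : i ≠ k := fun h => hz'.1 (by rw [h])
    have hjk : j ≠ k := fun h => hz'.2 (by rw [h])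
    have c3 : ∀ l, i ≠ l → j ≠ l → ({y i, y j, y l} : Finset ℕ).card = 3 := fun l h h' =>
      Finset.card_eq_three.2 ⟨_, _, _, hy, fun e => h (yinj e), fun e => h' (yinj e), rfl⟩
    have hbe : ({y i, y j, y k} : Finset ℕ) = b := by
      apply Finset.eq_of_subset_of_card_le
      · intro w hw
        simp only [Finset.mem_insert, Finset.mem_singleton] at hw
        rcases hw with rfl | rfl | rfl <;> assumption
      · rw [c3 k hik hjk, hcard]
    refine ⟨k, ⟨hij, hik, hjk, hbe ▸ hb⟩, ?_⟩
    rintro l ⟨-, hil, hjl, hl⟩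
    have : ({y i, y j, y l} : Finset ℕ) = b := hu _ ⟨hl, by simp, by simp⟩
    have hk : y l ∈ ({y i, y j, y k} : Finset ℕ) := by
      rw [hbe, ← this]; simp
    simp only [Finset.mem_insert, Finset.mem_singleton] at hk
    rcases hk with h | h | h
    · exact absurd (yinj h).symm hil
    · exact absurd (yinj h).symm hjl
    · exact yinj h
  · rintro i j k ⟨-, -, -, h⟩ ⟨a, hi, hj, hk⟩
    refine hgood (a.val + 1) (by omega) _ h ?_
    have aux : ∀ l : Fin 13, a ≤ l → l.val ≤ a + 4 →
        y l ∈ x '' (Set.Icc (a.val + 1) (a.val + 1 + 5 - 1) ∩ Set.Icc 1 13) := fun l h h' =>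
      ⟨l.val + 1, ⟨by
        have : a.val ≤ l.val := h
        simp only [Set.mem_Icc]; omega, mem l⟩, rfl⟩
    intro z hz
    simp only [Finset.coe_insert, Finset.coe_singleton, Set.mem_insert_iff,
      Set.mem_singleton_iff] at hz
    rcases hz with rfl | rfl | rfl
    · exact aux i hi.1 hi.2
    · exact aux j hj.1 hj.2
    · exact aux k hk.1 hk.2
end

section
/- No Steiner triple system of order 19 has a 7-good sequencing. -/
/-- Farkas weights on pairs of positions (row and column 0 unused). -/
def farkasTable : List (List Int) :=
  [
   [0, 0, 0, 0, 0, 0, 0, 0, 0, 0, 0, 0, 0, 0, 0, 0, 0, 0, 0, 0],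
   [0, 0, 4, 4, 4, 4, 4, 4, -8, -8, -5, -2, -2, -2, -2, -2, -2, -2, -2, -2],
   [0, 4, 0, 4, 4, 4, 4, 4, 4, -8, -5, -2, -2, -2, -2, -2, -2, -2, -2, -2],
   [0, 4, 4, 0, 4, 4, 4, 4, 4, 4, -5, -2, -2, -2, -2, -2, -2, -2, -2, -2],
   [0, 4, 4, 4, 0, 4, 4, 4, 4, 4, 1, -2, -2, -2, -2, -2, -2, -2, -2, -2],
   [0, 4, 4, 4, 4, 0, 4, 4, 4, 4, 1, -2, -2, -2, -2, -2, -2, -2, -2, -2],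
   [0, 4, 4, 4, 4, 4, 0, 4, 4, 4, 1, -2, -2, -2, -2, -2, -2, -2, -2, -2],
   [0, 4, 4, 4, 4, 4, 4, 0, 4, 4, 1, -2, -2, -2, -2, -2, -2, -2, -2, -2],
   [0, -8, 4, 4, 4, 4, 4, 4, 0, 4, 1, -2, -2, -2, -2, -2, -2, -2, -2, -2],
   [0, -8, -8, 4, 4, 4, 4, 4, 4, 0, 1, -2, -2, -2, -2, -2, -2, -2, -2, -2],
   [0, -5, -5, -5, 1, 1, 1, 1, 1, 1, 0, 1, 1, 1, 1, 1, 1, -5, -5, -5],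
   [0, -2, -2, -2, -2, -2, -2, -2, -2, -2, 1, 0, 4, 4, 4, 4, 4, 4, -8, -8],
   [0, -2, -2, -2, -2, -2, -2, -2, -2, -2, 1, 4, 0, 4, 4, 4, 4, 4, 4, -8],
   [0, -2, -2, -2, -2, -2, -2, -2, -2, -2, 1, 4, 4, 0, 4, 4, 4, 4, 4, 4],
   [0, -2, -2, -2, -2, -2, -2, -2, -2, -2, 1, 4, 4, 4, 0, 4, 4, 4, 4, 4],
   [0, -2, -2, -2, -2, -2, -2, -2, -2, -2, 1, 4, 4, 4, 4, 0, 4, 4, 4, 4],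
   [0, -2, -2, -2, -2, -2, -2, -2, -2, -2, 1, 4, 4, 4, 4, 4, 0, 4, 4, 4],
   [0, -2, -2, -2, -2, -2, -2, -2, -2, -2, -5, 4, 4, 4, 4, 4, 4, 0, 4, 4],
   [0, -2, -2, -2, -2, -2, -2, -2, -2, -2, -5, -8, 4, 4, 4, 4, 4, 4, 0, 4],
   [0, -2, -2, -2, -2, -2, -2, -2, -2, -2, -5, -8, -8, 4, 4, 4, 4, 4, 4, 0]]

/-- Weight of a pair of positions. -/
def farkasW (a b : ℕ) : ℤ := (farkasTable.getD a []).getD b 0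

theorem farkasW_symm : ∀ a ∈ Finset.Icc 1 19, ∀ b ∈ Finset.Icc 1 19,
    farkasW a b = farkasW b a := by decide +kernel

theorem farkasW_nonpos : ∀ a ∈ Finset.Icc 1 19, ∀ b ∈ Finset.Icc 1 19, ∀ c ∈ Finset.Icc 1 19,
    a < b → b < c → a + 7 ≤ c → farkasW a b + farkasW a c + farkasW b c ≤ 0 := by decide +kernel

theorem farkasW_sum : 0 < ∑ a ∈ Finset.Icc 1 19, ∑ b ∈ (Finset.Icc 1 19).erase a,
    farkasW a b := by decide +kernel

theorem no_third_map (t : ℕ → ℕ → ℕ)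
    (hmem : ∀ a ∈ Finset.Icc 1 19, ∀ b ∈ (Finset.Icc 1 19).erase a,
      t a b ∈ (Finset.Icc 1 19).erase a ∧ t a b ≠ b)
    (hinv : ∀ a ∈ Finset.Icc 1 19, ∀ b ∈ (Finset.Icc 1 19).erase a, t a (t a b) = b)
    (hsymm : ∀ a ∈ Finset.Icc 1 19, ∀ b ∈ (Finset.Icc 1 19).erase a, t a b = t b a)
    (hneg : ∀ a ∈ Finset.Icc 1 19, ∀ b ∈ (Finset.Icc 1 19).erase a,
      farkasW a b + farkasW a (t a b) + farkasW b (t a b) ≤ 0) : False := by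
  set I := Finset.Icc 1 19 with hI
  have h1 : ∀ a ∈ I, ∑ b ∈ I.erase a, farkasW a (t a b) = ∑ b ∈ I.erase a, farkasW a b := by
    intro a ha
    refine Finset.sum_bij' (fun b _ => t a b) (fun b _ => t a b) ?_ ?_ ?_ ?_ ?_
    · intro b hb; exact (hmem a ha b hb).1
    · intro b hb; exact (hmem a ha b hb).1
    · intro b hb; exact hinv a ha b hb
    · intro b hb; exact hinv a ha b hb
    · intro b hb; rfl
  have hswap : ∀ f : ℕ → ℕ → ℤ, ∑ a ∈ I, ∑ b ∈ I.erase a, f a b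
      = ∑ a ∈ I, ∑ b ∈ I.erase a, f b a := by
    intro f
    refine Finset.sum_comm' ?_
    intro a b
    simp only [Finset.mem_erase]
    tauto
  have h2 : ∑ a ∈ I, ∑ b ∈ I.erase a, farkasW b (t a b)
      = ∑ a ∈ I, ∑ b ∈ I.erase a, farkasW a b := by
    rw [hswap]
    refine Finset.sum_congr rfl fun a ha => ?_
    rw [← h1 a ha]
    refine Finset.sum_congr rfl fun b hb => ?_
    rw [hsymm a ha b hb]
  have h3 : ∑ a ∈ I, ∑ b ∈ I.erase a,
      (farkasW a b + farkasW a (t a b) + farkasW b (t a b)) ≤ 0 :=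
    Finset.sum_nonpos fun a ha => Finset.sum_nonpos fun b hb => hneg a ha b hb
  simp only [Finset.sum_add_distrib] at h3
  rw [h2, Finset.sum_congr rfl h1] at h3
  have := farkasW_sum
  rw [← hI] at this
  linarith

/-- No Steiner triple system of order 19 has a 7-good sequencing. -/
theorem no_seven_good_sequencing_of_sts_nineteen
    (B : Finset (Finset ℕ)) (hSTS : IsSTS 19 B) :
    ¬ ∃ x : ℕ → ℕ, IsGoodSeq 19 7 B x := by
  
  rintro ⟨x, ⟨hmaps, hinj, hsurj⟩, hgood⟩
  obtain ⟨hB, hP⟩ := hSTS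
  have hxI : ∀ a ∈ Finset.Icc 1 19, x a ∈ Finset.Icc 1 19 := by
    intro a ha
    have := hmaps (by simpa using ha : a ∈ Set.Icc 1 19)
    simpa using this
  have hxne : ∀ a ∈ Finset.Icc 1 19, ∀ b ∈ Finset.Icc 1 19, a ≠ b → x a ≠ x b := by
    intro a ha b hb hab h
    exact hab (hinj (by simpa using ha) (by simpa using hb) h)
  have hex : ∀ a b : ℕ, ∃ c : ℕ, a ∈ Finset.Icc 1 19 → b ∈ Finset.Icc 1 19 → a ≠ b →
      c ∈ Finset.Icc 1 19 ∧ c ≠ a ∧ c ≠ b ∧ ({x a, x b, x c} : Finset ℕ) ∈ B := by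
    intro a b
    by_cases h : a ∈ Finset.Icc 1 19 ∧ b ∈ Finset.Icc 1 19 ∧ a ≠ b
    · obtain ⟨ha, hb, hab⟩ := h
      have hne := hxne a ha b hb hab
      obtain ⟨s, ⟨hs, has, hbs⟩, -⟩ := hP _ (hxI a ha) _ (hxI b hb) hne
      obtain ⟨hsub, hcard⟩ := hB s hs
      have hb' : x b ∈ s.erase (x a) := Finset.mem_erase.2 ⟨hne.symm, hbs⟩
      have hc1 : ((s.erase (x a)).erase (x b)).card = 1 := by
        rw [Finset.card_erase_of_mem hb', Finset.card_erase_of_mem has, hcard]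
      obtain ⟨z, hz⟩ := Finset.card_eq_one.1 hc1
      have hzs : z ∈ (s.erase (x a)).erase (x b) := by rw [hz]; simp
      have hz1 : z ≠ x b := (Finset.mem_erase.1 hzs).1
      have hz2 : z ≠ x a := (Finset.mem_erase.1 (Finset.mem_erase.1 hzs).2).1
      have hz3 : z ∈ s := (Finset.mem_erase.1 (Finset.mem_erase.1 hzs).2).2
      have hzI := hsub hz3
      obtain ⟨c, hc, rfl⟩ := hsurj (by simpa using hzI : z ∈ Set.Icc 1 19)
      refine ⟨c, fun _ _ _ => ⟨by simpa using hc, ?_, ?_, ?_⟩⟩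
      · rintro rfl; exact hz2 rfl
      · rintro rfl; exact hz1 rfl
      · rw [← hz, Finset.insert_erase hb', Finset.insert_erase has]; exact hs
    · exact ⟨0, fun ha hb hab => absurd ⟨ha, hb, hab⟩ h⟩
  choose t ht using hex
  have huniq : ∀ a ∈ Finset.Icc 1 19, ∀ b ∈ Finset.Icc 1 19, a ≠ b →
      ∀ c ∈ Finset.Icc 1 19, c ≠ a → c ≠ b → ({x a, x b, x c} : Finset ℕ) ∈ B → t a b = c := by
    intro a ha b hb hab c hc hca hcb hcB
    obtain ⟨h1, h2, h3, h4⟩ := ht a b ha hb hab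
    have heq := (hP _ (hxI a ha) _ (hxI b hb) (hxne a ha b hb hab)).unique
      ⟨hcB, by simp, by simp⟩ ⟨h4, by simp, by simp⟩
    have hcm : x c ∈ ({x a, x b, x (t a b)} : Finset ℕ) := by rw [← heq]; simp
    simp only [Finset.mem_insert, Finset.mem_singleton] at hcm
    rcases hcm with h | h | h
    · exact absurd h (hxne c hc a ha hca)
    · exact absurd h (hxne c hc b hb hcb)
    · by_contra hne
      exact hxne c hc _ h1 (Ne.symm hne) h
  -- every block has span at least seven
  have hspan : ∀ a ∈ Finset.Icc 1 19, ∀ b ∈ Finset.Icc 1 19, ∀ c ∈ Finset.Icc 1 19,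
      ({x a, x b, x c} : Finset ℕ) ∈ B → a < b → b < c → a + 7 ≤ c := by
    intro a ha b hb c hc hm hab hbc
    by_contra hlt
    simp only [Finset.mem_Icc] at ha hb hc
    refine hgood a ha.1 _ hm ?_
    intro z hz
    simp only [Finset.coe_insert, Finset.coe_singleton, Set.mem_insert_iff,
      Set.mem_singleton_iff] at hz
    rcases hz with rfl | rfl | rfl
    · exact ⟨a, ⟨⟨by omega, by omega⟩, ⟨by omega, by omega⟩⟩, rfl⟩
    · exact ⟨b, ⟨⟨by omega, by omega⟩, ⟨by omega, by omega⟩⟩, rfl⟩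
    · exact ⟨c, ⟨⟨by omega, by omega⟩, ⟨by omega, by omega⟩⟩, rfl⟩
  have hsorted : ∀ a ∈ Finset.Icc 1 19, ∀ b ∈ Finset.Icc 1 19, ∀ c ∈ Finset.Icc 1 19,
      ({x a, x b, x c} : Finset ℕ) ∈ B → a < b → b < c →
      farkasW a b + farkasW a c + farkasW b c ≤ 0 := fun a ha b hb c hc hm h1 h2 =>
    farkasW_nonpos a ha b hb c hc h1 h2 (hspan a ha b hb c hc hm h1 h2)
  have p1 : ∀ u v w : ℕ, ({u, v, w} : Finset ℕ) = {v, u, w} := by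
    intro u v w; ext z; simp only [Finset.mem_insert, Finset.mem_singleton]; tauto
  have p2 : ∀ u v w : ℕ, ({u, v, w} : Finset ℕ) = {u, w, v} := by
    intro u v w; ext z; simp only [Finset.mem_insert, Finset.mem_singleton]; tauto
  refine no_third_map t ?_ ?_ ?_ ?_
  · intro a ha b hb
    obtain ⟨hba, hb⟩ := Finset.mem_erase.1 hb
    obtain ⟨h1, h2, h3, h4⟩ := ht a b ha hb hba.symm
    exact ⟨Finset.mem_erase.2 ⟨h2, h1⟩, h3⟩
  · intro a ha b hb
    obtain ⟨hba, hb⟩ := Finset.mem_erase.1 hb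
    obtain ⟨h1, h2, h3, h4⟩ := ht a b ha hb hba.symm
    exact huniq a ha _ h1 h2.symm b hb hba h3.symm (by rw [p2]; exact h4)
  · intro a ha b hb
    obtain ⟨hba, hb⟩ := Finset.mem_erase.1 hb
    obtain ⟨h1, h2, h3, h4⟩ := ht b a hb ha hba
    exact huniq a ha b hb hba.symm _ h1 h3 h2 (by rw [p1]; exact h4)
  · intro a ha b hb
    obtain ⟨hba, hb⟩ := Finset.mem_erase.1 hb
    obtain ⟨h1, h2, h3, h4⟩ := ht a b ha hb hba.symm
    generalize t a b = c at h1 h2 h3 h4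
    have s1 := farkasW_symm a ha b hb
    have s2 := farkasW_symm a ha c h1
    have s3 := farkasW_symm b hb c h1
    rcases lt_or_gt_of_ne hba with hlt | hlt <;> rcases lt_or_gt_of_ne h2 with hlt2 | hlt2 <;>
      rcases lt_or_gt_of_ne h3 with hlt3 | hlt3
    · have := hsorted c h1 b hb a ha (by rw [p1, p2, p1]; exact h4) hlt3 hlt
      linarith
    · have := hsorted b hb c h1 a ha (by rw [p2, p1]; exact h4) hlt3 hlt2
      linarith
    · omega
    · have := hsorted b hb a ha c h1 (by rw [p1]; exact h4) hlt hlt2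
      linarith
    · have := hsorted c h1 a ha b hb (by rw [p1, p2]; exact h4) hlt2 hlt
      linarith
    · omega
    · have := hsorted a ha c h1 b hb (by rw [p2]; exact h4) hlt2 hlt3
      linarith
    · have := hsorted a ha b hb c h1 h4 hlt hlt3
      linarith
end
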